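/- Let (G,ω) be a conformal graph, H a connected induced subgraph, c ∈ V_H, and let τ be chosen uniformly at random from [0,Δ]. Then for every v ∈ V_H and R ≥ 0, the probability that the skinny ball B_ω^H(v,R) avoids cut_Δ(H,c;τ) = ⋃_{k ∈ ℤ≥0} S_ω^H(c, τ + kΔ) is at least 1 − 2R/Δ. -/

import Mathlib

open Finset MeasureTheory Classical

noncomputable section

def wlen {V : Type*} {G : SimpleGraph V} (ω : V → ℝ) {u v : V} (w : G.Walk u v) : ℝ :=
  (w.darts.map (fun d => (ω d.toProd.1 + ω d.toProd.2) / 2)).sum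

noncomputable def distw {V : Type*} (G : SimpleGraph V) (ω : V → ℝ) (u v : V) : ℝ :=
  sInf {x | ∃ w : G.Walk u v, wlen ω w = x}

noncomputable def vbdry {V : Type*} [Fintype V] (G : SimpleGraph V) (U : Finset V) : Finset V :=
  U.filter (fun v => ∃ u ∉ U, G.Adj v u)

noncomputable def phi {V : Type*} [Fintype V] (G : SimpleGraph V) : ℝ :=
  sInf { r | ∃ U : Finset V, U.Nonempty ∧
    ((U \ vbdry G U).card : ℝ) ≤ (Fintype.card V : ℝ) / 2 ∧
    r = ((vbdry G U).card : ℝ) / (U.card : ℝ) }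

noncomputable def sobs {X : Type*} [Fintype X] (d : X → X → ℝ) : ℝ :=
  sSup { s | ∃ f : X → ℝ, (∀ x y, |f x - f y| ≤ d x y) ∧
    s = (∑ x : X, ∑ y : X, |f x - f y|) / ((Fintype.card X : ℝ))^2 }

noncomputable def spread {X : Type*} [Fintype X] (d : X → X → ℝ) : ℝ :=
  (∑ x : X, ∑ y : X, d x y) / ((Fintype.card X : ℝ))^2

noncomputable def csobs {V : Type*} [Fintype V] (G : SimpleGraph V) : ℝ :=
  sSup { s | ∃ ω : V → ℝ, (∀ v, 0 ≤ ω v) ∧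
    (∑ v : V, ω v) / (Fintype.card V : ℝ) ≤ 1 ∧ s = sobs (distw G ω) }

theorem wlen_append {V : Type*} {G : SimpleGraph V} (ω : V → ℝ) {u v w : V}
    (p : G.Walk u v) (q : G.Walk v w) : wlen ω (p.append q) = wlen ω p + wlen ω q := by
  simp [wlen]

theorem wlen_reverse {V : Type*} {G : SimpleGraph V} (ω : V → ℝ) {u v : V}
    (p : G.Walk u v) : wlen ω p.reverse = wlen ω p := by
  simp [wlen, SimpleGraph.Walk.darts_reverse, Function.comp_def, List.sum_reverse, add_comm]

theorem wlen_nonneg {V : Type*} {G : SimpleGraph V} {ω : V → ℝ} (hω : ∀ v, 0 ≤ ω v) {u v : V}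
    (p : G.Walk u v) : 0 ≤ wlen ω p := by
  refine List.sum_nonneg fun x hx => ?_
  obtain ⟨d, -, rfl⟩ := List.mem_map.1 hx
  have := hω d.toProd.1
  have := hω d.toProd.2
  positivity

theorem distw_le_wlen {V : Type*} {G : SimpleGraph V} {ω : V → ℝ} (hω : ∀ v, 0 ≤ ω v) {u v : V}
    (p : G.Walk u v) : distw G ω u v ≤ wlen ω p :=
  csInf_le ⟨0, by rintro _ ⟨q, rfl⟩; exact wlen_nonneg hω q⟩ ⟨p, rfl⟩

theorem distw_comm {V : Type*} (G : SimpleGraph V) (ω : V → ℝ) (u v : V) :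
    distw G ω u v = distw G ω v u := by
  unfold distw
  congr 1
  ext x
  exact ⟨fun ⟨p, hp⟩ => ⟨p.reverse, (wlen_reverse ω p).trans hp⟩,
    fun ⟨p, hp⟩ => ⟨p.reverse, (wlen_reverse ω p).trans hp⟩⟩

theorem exists_wlen_lt {V : Type*} {G : SimpleGraph V} (hG : G.Connected) (ω : V → ℝ) {u v : V}
    {x : ℝ} (hx : distw G ω u v < x) : ∃ p : G.Walk u v, wlen ω p < x := by
  obtain ⟨p⟩ := hG.preconnected u v
  obtain ⟨_, ⟨q, rfl⟩, hq⟩ := exists_lt_of_csInf_lt (s := {x | ∃ w : G.Walk u v, wlen ω w = x})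
    ⟨_, p, rfl⟩ hx
  exact ⟨q, hq⟩

theorem distw_triangle {V : Type*} {G : SimpleGraph V} (hG : G.Connected) {ω : V → ℝ}
    (hω : ∀ v, 0 ≤ ω v) (u v w : V) : distw G ω u w ≤ distw G ω u v + distw G ω v w := by
  refine le_of_forall_pos_lt_add fun ε hε => ?_
  obtain ⟨p, hp⟩ := exists_wlen_lt hG ω (lt_add_of_pos_right (distw G ω u v) (half_pos hε))
  obtain ⟨q, hq⟩ := exists_wlen_lt hG ω (lt_add_of_pos_right (distw G ω v w) (half_pos hε))
  have := distw_le_wlen hω (p.append q)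
  rw [wlen_append] at this
  linarith

/-- The part of `[0, Δ)` whose translates by nonnegative multiples of `Δ` meet a set `s` has
measure at most that of `s`. -/
theorem volume_iUnion_translate_inter_Ico_le {Δ : ℝ} (hΔ : 0 < Δ) {s : Set ℝ}
    (hs : MeasurableSet s) :
    volume (⋃ k : ℕ, {τ : ℝ | τ + k * Δ ∈ s} ∩ Set.Ico 0 Δ) ≤ volume s := by
  set t : ℕ → Set ℝ := fun k => s ∩ Set.Ico (k * Δ) ((k + 1) * Δ)
  have hpre (k : ℕ) : {τ : ℝ | τ + k * Δ ∈ s} ∩ Set.Ico 0 Δ = (fun τ => τ + k * Δ) ⁻¹' t k := by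
    ext τ
    simp only [t, Set.mem_inter_iff, Set.mem_ofPred_eq, Set.mem_preimage, Set.mem_Ico]
    exact and_congr_right fun _ => and_congr (by constructor <;> intro h <;> linarith)
      (by constructor <;> intro h <;> linarith)
  have hdisj : Pairwise (Function.onFun Disjoint t) := by
    refine (pairwise_disjoint_on t).2 fun m n hmn => ?_
    refine Set.disjoint_left.2 fun x hxm hxn => ?_
    have hle : ((m : ℝ) + 1) * Δ ≤ n * Δ := by
      gcongr
      exact_mod_cast hmn
    linarith [hxm.2.2, hxn.2.1]
  calc volume (⋃ k : ℕ, {τ : ℝ | τ + k * Δ ∈ s} ∩ Set.Ico 0 Δ)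
      ≤ ∑' k : ℕ, volume ({τ : ℝ | τ + k * Δ ∈ s} ∩ Set.Ico 0 Δ) := measure_iUnion_le _
    _ = ∑' k : ℕ, volume (t k) := by simp_rw [hpre, measure_preimage_add_right]
    _ = volume (⋃ k, t k) := (measure_iUnion hdisj fun _ => hs.inter measurableSet_Ico).symm
    _ ≤ volume s := measure_mono (Set.iUnion_subset fun _ => Set.inter_subset_left)

theorem stmt19 {V : Type*} (G : SimpleGraph V) (HS : Set V)
    (hconn : (G.induce HS).Connected) (ω : V → ℝ) (hω : ∀ v : V, 0 ≤ ω v)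
    (c : HS) (Δ : ℝ) (hΔ : 0 < Δ) (v : HS) (R : ℝ) (hR : 0 ≤ R) :
    1 - 2 * R / Δ ≤
      (((ENNReal.ofReal Δ)⁻¹ • MeasureTheory.volume.restrict (Set.Icc (0 : ℝ) Δ))
        {τ : ℝ | ∀ u : HS, distw (G.induce HS) (fun a : HS => ω a) v u < R - ω u / 2 →
          ¬ ∃ k : ℕ,
            distw (G.induce HS) (fun a : HS => ω a) c u - ω u / 2 ≤ τ + (k : ℝ) * Δ ∧
              τ + (k : ℝ) * Δ ≤
                distw (G.induce HS) (fun a : HS => ω a) c u + ω u / 2}).toReal := by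
  set d := distw (G.induce HS) (fun a : HS => ω a)
  set s : Set ℝ := Set.Ioo (d c v - R) (d c v + R)
  set B : Set ℝ := ⋃ k : ℕ, {τ : ℝ | τ + k * Δ ∈ s} ∩ Set.Ico 0 Δ
  set A : Set ℝ := {τ : ℝ | ∀ u : HS, d v u < R - ω u / 2 →
    ¬ ∃ k : ℕ, d c u - ω u / 2 ≤ τ + (k : ℝ) * Δ ∧ τ + (k : ℝ) * Δ ≤ d c u + ω u / 2}
  have hsub : Set.Ico 0 Δ \ B ⊆ A ∩ Set.Icc 0 Δ := by
    rintro τ ⟨hτ, hτB⟩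
    refine ⟨?_, Set.Ico_subset_Icc_self hτ⟩
    rintro u hu ⟨k, hk₁, hk₂⟩
    have h₁ : d c u ≤ d c v + d v u := distw_triangle hconn (fun a => hω a) c v u
    have h₂ : d c v ≤ d c u + d u v := distw_triangle hconn (fun a => hω a) c u v
    have h₃ : d u v = d v u := distw_comm _ _ u v
    exact hτB (Set.mem_iUnion.2 ⟨k, ⟨by linarith, by linarith⟩, hτ⟩)
  have hvol : ENNReal.ofReal (Δ - 2 * R) ≤ volume.restrict (Set.Icc 0 Δ) A := calc
    ENNReal.ofReal (Δ - 2 * R) = volume (Set.Ico 0 Δ) - volume s := by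
      rw [Real.volume_Ico, Real.volume_Ioo, ← ENNReal.ofReal_sub _ (by linarith)]
      congr 1
      ring
    _ ≤ volume (Set.Ico 0 Δ) - volume B :=
      tsub_le_tsub_left (volume_iUnion_translate_inter_Ico_le hΔ measurableSet_Ioo) _
    _ ≤ volume (Set.Ico 0 Δ \ B) := le_measure_sdiff
    _ ≤ volume (A ∩ Set.Icc 0 Δ) := measure_mono hsub
    _ ≤ volume.restrict (Set.Icc 0 Δ) A := Measure.le_restrict_apply _ _
  have hfin : volume.restrict (Set.Icc 0 Δ) A ≠ ⊤ := measure_ne_top _ _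
  rw [Measure.smul_apply, smul_eq_mul, ENNReal.toReal_mul, ENNReal.toReal_inv,
    ENNReal.toReal_ofReal hΔ.le]
  calc 1 - 2 * R / Δ = Δ⁻¹ * (Δ - 2 * R) := by field_simp
    _ ≤ _ := by
      gcongr
      exact (ENNReal.ofReal_le_iff_le_toReal hfin).1 hvol

end
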